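/- Let p(z) = a_0 z^n + a_1 z^{n−1} + ⋯ + a_n be a real polynomial of degree n ≥ 1 with a_0 > 0, let s_0, s_1, s_2, … be the Laurent coefficients at infinity of R(z) = (−1)^n p(−z)/p(z), and let D_j(R) = det[(s_{i+k})_{i,k=0}^{j−1}]. Then for every integer j ≥ 1, a_0^{2j} · D_j(R) = (−1)^{j(j+1)/2} · 2^j · a_0 · Δ_{j−1}(p) · Δ_j(p), where Δ_k(p) are the Hurwitz minors of p and Δ_0(p) = 1. -/

import Mathlib

open Polynomial

/-- The coefficient `a_m` of `z^(n-m)` in `p` (where `n = p.natDegree`), with the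
convention `a_m = 0` for `m < 0` or `m > n`. -/
noncomputable def aCoeff (p : Polynomial ℝ) (m : ℤ) : ℝ :=
  if 0 ≤ m ∧ m ≤ (p.natDegree : ℤ) then p.coeff (p.natDegree - m.toNat) else 0

/-- The `k`-th Hurwitz minor `Δ_k(p) = det[(a_{2j-i})]` with `i, j` running over `1, …, k`;
`Δ_0(p) = 1` (determinant of the empty matrix). -/
noncomputable def hurwitzMinor (p : Polynomial ℝ) (k : ℕ) : ℝ :=
  Matrix.det (Matrix.of fun i j : Fin k =>
    aCoeff p (2 * ((j : ℤ) + 1) - ((i : ℤ) + 1)))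

open Matrix

theorem Fin.prod_Iio_eq_prod_ite {M : Type*} [CommMonoid M] {n : ℕ} (f : Fin n → M) (y : Fin n) :
    ∏ x ∈ Finset.Iio y, f x = ∏ x, if x < y then f x else 1 := by
  rw [← Finset.prod_filter]
  exact Finset.prod_congr (by ext; simp) fun _ _ => rfl

theorem Fin.prod_ite_lt_neg_one {j : ℕ} (k : Fin j) :
    ∏ x : Fin j, (if x < k then (-1 : ℤˣ) else 1) = (-1) ^ (k : ℕ) := by
  rw [← Fin.prod_Iio_eq_prod_ite (fun _ => (-1 : ℤˣ))]
  simp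

theorem Fin.prod_neg_one_pow {M : Type*} [CommRing M] (j : ℕ) :
    ∏ i : Fin j, (-1 : M) ^ (i : ℕ) = (-1) ^ (j * (j - 1) / 2) := by
  rw [Fin.prod_univ_eq_prod_range (fun i => (-1 : M) ^ i), Finset.prod_pow_eq_pow_sum,
    Finset.sum_range_id]

theorem Fin.sign_revPerm_eq (j : ℕ) :
    Equiv.Perm.sign (Fin.revPerm : Equiv.Perm (Fin j)) = (-1) ^ (j * (j - 1) / 2) := by
  rw [Equiv.Perm.sign_eq_prod_prod_Iio]
  simp_rw [Fin.prod_Iio_eq_prod_ite]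
  have h (k : Fin j) : (∏ x : Fin j, if x < k then
      (if Fin.revPerm x < Fin.revPerm k then (1 : ℤˣ) else -1) else 1) = (-1) ^ (k : ℕ) := by
    rw [← Fin.prod_ite_lt_neg_one]
    refine Finset.prod_congr rfl fun x _ => ?_
    simp only [Fin.revPerm_apply, Fin.rev_lt_rev]
    split_ifs <;> first | rfl | omega
  simp_rw [h]
  rw [Fin.prod_univ_eq_prod_range (fun i => (-1 : ℤˣ) ^ i), Finset.prod_pow_eq_pow_sum,
    Finset.sum_range_id]

/-- The permutation of `{0, …, 2j - 1}` listing the even numbers first and then the odd ones. -/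
noncomputable def evenOddPerm (j : ℕ) : Equiv.Perm (Fin (j + j)) :=
  Equiv.ofBijective
    (fun x => ⟨if (x : ℕ) < j then 2 * x else 2 * (x - j) + 1, by split_ifs <;> omega⟩)
    (Finite.injective_iff_bijective.mp fun x y h => by
      simp only [Fin.mk.injEq] at h
      ext
      split_ifs at h <;> omega)

theorem evenOddPerm_castAdd {j : ℕ} (i : Fin j) :
    (evenOddPerm j (Fin.castAdd j i) : ℕ) = 2 * i := by
  simp [evenOddPerm]

theorem evenOddPerm_natAdd {j : ℕ} (i : Fin j) :
    (evenOddPerm j (Fin.natAdd j i) : ℕ) = 2 * i + 1 := by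
  simp [evenOddPerm]

theorem sign_evenOddPerm (j : ℕ) :
    Equiv.Perm.sign (evenOddPerm j) = (-1) ^ (j * (j - 1) / 2) := by
  rw [← Fin.sign_revPerm_eq, Equiv.Perm.sign_eq_prod_prod_Iio, Equiv.Perm.sign_eq_prod_prod_Iio]
  simp_rw [Fin.prod_Iio_eq_prod_ite, Fin.prod_univ_add, Fin.revPerm_apply, Fin.rev_lt_rev,
    Fin.lt_def, evenOddPerm_castAdd, evenOddPerm_natAdd, Fin.val_castAdd, Fin.val_natAdd,
    Finset.prod_mul_distrib]
  have h1 : ∏ y : Fin j, ∏ x : Fin j, (if (x : ℕ) < y then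
      (if 2 * (x : ℕ) < 2 * y then (1 : ℤˣ) else -1) else 1) = 1 :=
    Finset.prod_eq_one fun y _ => Finset.prod_eq_one fun x _ => by
      split_ifs <;> first | rfl | omega
  have h2 : ∏ y : Fin j, ∏ x : Fin j, (if j + (x : ℕ) < y then
      (if 2 * (x : ℕ) + 1 < 2 * y then (1 : ℤˣ) else -1) else 1) = 1 :=
    Finset.prod_eq_one fun y _ => Finset.prod_eq_one fun x _ => by
      split_ifs <;> first | rfl | omega
  have h3 : ∏ y : Fin j, ∏ x : Fin j, (if j + (x : ℕ) < j + y then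
      (if 2 * (x : ℕ) + 1 < 2 * y + 1 then (1 : ℤˣ) else -1) else 1) = 1 :=
    Finset.prod_eq_one fun y _ => Finset.prod_eq_one fun x _ => by
      split_ifs <;> first | rfl | omega
  rw [h1, h2, h3, Finset.prod_comm]
  simp only [one_mul, mul_one]
  refine Finset.prod_congr rfl fun y _ => Finset.prod_congr rfl fun x _ => ?_
  split_ifs <;> first | rfl | omega

namespace PowerSeries

/-- The `2j × 2j` matrix whose rows hold the coefficients of `X ^ i * A` and of `X ^ i * B`
for `i < j`, the columns being picked out by `c`. -/
noncomputable def stackedCoeffMatrix {R : Type*} [CommRing R] (A B : R⟦X⟧) {j : ℕ}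
    (c : Fin j ⊕ Fin j → ℕ) : Matrix (Fin j ⊕ Fin j) (Fin j ⊕ Fin j) R :=
  Matrix.of fun r k => coeff (c k) (Sum.elim
    (fun i : Fin j => X ^ (i : ℕ) * A) (fun i : Fin j => X ^ (i : ℕ) * B) r)

theorem det_stackedCoeffMatrix_evenOdd {R : Type*} [CommRing R] (A B : R⟦X⟧) (j : ℕ) :
    (stackedCoeffMatrix A B
        (Sum.elim (fun k : Fin j => 2 * (k : ℕ)) (fun k : Fin j => 2 * (k : ℕ) + 1))).det =
      (-1) ^ (j * (j - 1) / 2) * (stackedCoeffMatrix A B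
        (Sum.elim (fun k : Fin j => (k : ℕ)) (fun k : Fin j => j + (k : ℕ)))).det := by
  rw [← det_submatrix_equiv_self (finSumFinEquiv (m := j) (n := j)).symm,
    ← det_submatrix_equiv_self (finSumFinEquiv (m := j) (n := j)).symm
      (stackedCoeffMatrix A B (Sum.elim (fun k : Fin j => (k : ℕ)) (fun k : Fin j => j + (k : ℕ))))]
  have h := det_permute' (evenOddPerm j) ((stackedCoeffMatrix A B
    (Sum.elim (fun k : Fin j => (k : ℕ)) (fun k : Fin j => j + (k : ℕ)))).submatrix
      (finSumFinEquiv (m := j) (n := j)).symm (finSumFinEquiv (m := j) (n := j)).symm)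
  rw [sign_evenOddPerm] at h
  simp only [Units.val_pow_eq_pow_val, Units.val_neg, Units.val_one, Int.cast_pow, Int.cast_neg,
    Int.cast_one] at h
  rw [← h]
  congr 1
  have hpos (x : Fin (j + j)) : Sum.elim (fun k : Fin j => (k : ℕ)) (fun k : Fin j => j + (k : ℕ))
      (finSumFinEquiv.symm x) = x := by
    refine Fin.addCases (fun i => ?_) (fun i => ?_) x <;> simp [-Fin.natAdd_eq_addNat]
  ext r k
  simp only [submatrix_apply, stackedCoeffMatrix, Matrix.of_apply, id, hpos]
  congr 2
  refine Fin.addCases (fun i => ?_) (fun i => ?_) k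
  · simp [evenOddPerm_castAdd]
  · simp [evenOddPerm_natAdd, -Fin.natAdd_eq_addNat]

theorem coeff_mul_eq_sum_range {R : Type*} [CommRing R] (F G : R⟦X⟧)
    {k N : ℕ} (hk : k < N) :
    coeff k (F * G) = ∑ m ∈ Finset.range N, coeff m F * coeff k (X ^ m * G) := by
  rw [coeff_mul, Finset.Nat.sum_antidiagonal_eq_sum_range_succ
    (fun a b => coeff a F * coeff b G)]
  simp_rw [coeff_X_pow_mul', mul_ite, mul_zero]
  rw [← Finset.sum_filter]
  refine Finset.sum_congr ?_ fun _ _ => rfl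
  ext m
  simp only [Finset.mem_range, Finset.mem_filter]
  omega

theorem det_toeplitz {R : Type*} [CommRing R] (A : R⟦X⟧) (j : ℕ) :
    (Matrix.of fun i k : Fin j => coeff (k : ℕ) (X ^ (i : ℕ) * A)).det =
      coeff 0 A ^ j := by
  rw [det_of_isUpperTriangular]
  · simp [coeff_X_pow_mul']
  · intro i k h
    simp only [id] at h
    simp [coeff_X_pow_mul', h]

theorem det_stackedCoeffMatrix_mul {R : Type*} [CommRing R] (A S : R⟦X⟧) (j : ℕ) :
    (stackedCoeffMatrix A (A * S)
        (Sum.elim (fun k : Fin j => (k : ℕ)) (fun k : Fin j => j + (k : ℕ)))).det =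
      coeff 0 A ^ (2 * j) *
        (Matrix.of fun i k : Fin j => coeff (j + k) (X ^ (i : ℕ) * S)).det := by
  have hM : stackedCoeffMatrix A (A * S)
        (Sum.elim (fun k : Fin j => (k : ℕ)) (fun k : Fin j => j + (k : ℕ))) =
      fromBlocks 1 0 (Matrix.of fun i k : Fin j => coeff (k : ℕ) (X ^ (i : ℕ) * S))
        (Matrix.of fun i k : Fin j => coeff (j + k) (X ^ (i : ℕ) * S)) *
      fromBlocks (Matrix.of fun i k : Fin j => coeff (k : ℕ) (X ^ (i : ℕ) * A))
        (Matrix.of fun i k : Fin j => coeff (j + k) (X ^ (i : ℕ) * A)) 0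
        (Matrix.of fun i k : Fin j => coeff (k : ℕ) (X ^ (i : ℕ) * A)) := by
    rw [fromBlocks_multiply]
    have key (i k : ℕ) (hk : k < j + j) : coeff k (X ^ i * (A * S)) =
        ∑ m : Fin j, coeff m (X ^ i * S) * coeff k (X ^ (m : ℕ) * A) +
        ∑ m : Fin j, coeff (j + m) (X ^ i * S) *
          coeff k (X ^ (j + m : ℕ) * A) := by
      rw [mul_comm A S, ← mul_assoc, coeff_mul_eq_sum_range _ _ hk, Finset.sum_range,
        Fin.sum_univ_add]
      simp [-Fin.natAdd_eq_addNat]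
    ext (i | i) (k | k)
    · simp [stackedCoeffMatrix]
    · simp [stackedCoeffMatrix]
    · simp only [stackedCoeffMatrix, Matrix.of_apply, Sum.elim_inl, Sum.elim_inr,
        fromBlocks_apply₂₁, Matrix.mul_apply, Matrix.mul_zero, add_zero]
      rw [key _ _ (by omega), add_eq_left]
      refine Finset.sum_eq_zero fun m _ => ?_
      rw [coeff_X_pow_mul' A, if_neg (by omega), mul_zero]
    · simp only [stackedCoeffMatrix, Matrix.of_apply, Sum.elim_inr,
        fromBlocks_apply₂₂, Matrix.add_apply, Matrix.mul_apply]
      rw [key _ _ (by omega)]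
      congr 1
      refine Finset.sum_congr rfl fun m _ => ?_
      rw [pow_add, mul_assoc, add_comm j k, add_comm j m, coeff_X_pow_mul]
  rw [hM, det_mul, det_fromBlocks_zero₁₂, det_fromBlocks_zero₂₁, det_toeplitz, det_one]
  ring

theorem det_stackedCoeffMatrix_neg {R : Type*} [CommRing R] (A B : R⟦X⟧)
    (hB : ∀ k, coeff k B = (-1) ^ k * coeff k A) (j : ℕ) :
    (-2) ^ j * (-1) ^ (j * (j - 1) / 2) * (stackedCoeffMatrix A B
        (Sum.elim (fun k : Fin j => 2 * (k : ℕ)) (fun k : Fin j => 2 * (k : ℕ) + 1))).det =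
      2 ^ j * (Matrix.of fun i k : Fin j => coeff (2 * k) (X ^ (i : ℕ) * A)).det *
      (2 ^ j *
        (Matrix.of fun i k : Fin j => coeff (2 * k + 1) (X ^ (i : ℕ) * A)).det) := by
  have hsign (i m : ℕ) : (-1) ^ i * coeff m (X ^ i * B) =
      (-1) ^ m * coeff m (X ^ i * A) := by
    rw [coeff_X_pow_mul', coeff_X_pow_mul']
    split_ifs with h
    · rw [hB, ← mul_assoc, ← pow_add, Nat.add_sub_cancel' h]
    · simp
  let D : Matrix (Fin j) (Fin j) R := diagonal fun i => (-1) ^ (i : ℕ)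
  have hG : (fromBlocks 1 D 1 (-D)).det = (-2) ^ j * (-1) ^ (j * (j - 1) / 2) := by
    rw [det_fromBlocks_one₁₁, Matrix.one_mul, show -D - D = (-2 : R) • D by module, det_smul,
      det_diagonal, Fin.prod_neg_one_pow, Fintype.card_fin]
  rw [← hG, ← det_mul]
  have hM : fromBlocks 1 D 1 (-D) * stackedCoeffMatrix A B
        (Sum.elim (fun k : Fin j => 2 * (k : ℕ)) (fun k : Fin j => 2 * (k : ℕ) + 1)) =
      fromBlocks
        ((2 : R) • Matrix.of fun i k : Fin j => coeff (2 * k) (X ^ (i : ℕ) * A)) 0 0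
        ((2 : R) • Matrix.of fun i k : Fin j =>
          coeff (2 * k + 1) (X ^ (i : ℕ) * A)) := by
    rw [← fromBlocks_toBlocks (stackedCoeffMatrix A B _), fromBlocks_multiply]
    congr 1 <;> ext i k <;>
      simp [D, stackedCoeffMatrix, toBlocks₁₁, toBlocks₁₂, toBlocks₂₁, toBlocks₂₂, hsign,
        pow_succ, pow_mul] <;> ring
  rw [hM, det_fromBlocks_zero₁₂, det_smul, det_smul, Fintype.card_fin]

theorem det_even_columns_succ {R : Type*} [CommRing R] (A : R⟦X⟧) (j : ℕ) :
    (Matrix.of fun i k : Fin (j + 1) => coeff (2 * k) (X ^ (i : ℕ) * A)).det =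
      coeff 0 A *
        (Matrix.of fun i k : Fin j => coeff (2 * k + 1) (X ^ (i : ℕ) * A)).det := by
  rw [det_succ_column_zero, Fin.sum_univ_succ]
  rw [Finset.sum_eq_zero fun i _ => by simp [coeff_X_pow_mul']]
  simp only [Fin.val_zero, pow_zero, one_mul, Matrix.of_apply, mul_zero, add_zero]
  congr 2
  ext i k
  simp [coeff_X_pow_mul', show 2 * ((k : ℕ) + 1) = 2 * k + 1 + 1 by ring]

theorem det_hankel_eq {R : Type*} [CommRing R] [IsDomain R] [CharZero R]
    (A S : R⟦X⟧) (hAS : ∀ k, coeff k (A * S) = (-1) ^ k * coeff k A) (j : ℕ) :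
    coeff 0 A ^ (2 * (j + 1)) *
        (Matrix.of fun i k : Fin (j + 1) => coeff (i + k + 1) S).det =
      (-1) ^ ((j + 1) * (j + 1 + 1) / 2) * 2 ^ (j + 1) * coeff 0 A *
        (Matrix.of fun i k : Fin j => coeff (2 * k + 1) (X ^ (i : ℕ) * A)).det *
        (Matrix.of fun i k : Fin (j + 1) =>
          coeff (2 * k + 1) (X ^ (i : ℕ) * A)).det := by
  have h := det_stackedCoeffMatrix_neg A (A * S) hAS (j + 1)
  rw [det_stackedCoeffMatrix_evenOdd, det_stackedCoeffMatrix_mul, det_even_columns_succ] at h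
  have hrev : (Matrix.of fun i k : Fin (j + 1) =>
      coeff (j + 1 + k) (X ^ (i : ℕ) * S)).det =
      (-1) ^ ((j + 1) * (j + 1 - 1) / 2) *
        (Matrix.of fun i k : Fin (j + 1) => coeff (i + k + 1) S).det := by
    have := det_permute Fin.revPerm (Matrix.of fun i k : Fin (j + 1) => coeff (i + k + 1) S)
    rw [Fin.sign_revPerm_eq] at this
    simp only [Units.val_pow_eq_pow_val, Units.val_neg, Units.val_one, Int.cast_pow, Int.cast_neg,
      Int.cast_one] at this
    rw [← this]
    congr 1
    ext i k
    simp only [Matrix.of_apply, submatrix_apply, id, Fin.revPerm_apply, Fin.val_rev,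
      coeff_X_pow_mul']
    rw [if_pos (by omega)]
    congr 2
    omega
  rw [hrev] at h
  have hexp : (j + 1) * (j + 1 + 1) / 2 = (j + 1) * (j + 1 - 1) / 2 + (j + 1) := by
    rw [Nat.add_sub_cancel, show (j + 1) * (j + 1 + 1) = (j + 1) * j + (j + 1) * 2 by ring,
      Nat.add_mul_div_right _ _ two_pos]
  rw [hexp, pow_add]
  set e : R := (-1) ^ ((j + 1) * (j + 1 - 1) / 2)
  have he : e * e = 1 := by rw [← mul_pow]; simp
  set f : R := (-1) ^ (j + 1)
  have hf : f * f = 1 := by rw [← mul_pow]; simp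
  rw [show (-2 : R) ^ (j + 1) = f * 2 ^ (j + 1) by rw [← mul_pow]; simp] at h
  apply mul_left_cancel₀ (pow_ne_zero (j + 1) (two_ne_zero : (2 : R) ≠ 0))
  linear_combination (e * f) * h -
    2 ^ (j + 1) * coeff 0 A ^ (2 * (j + 1)) *
      (Matrix.of fun i k : Fin (j + 1) => coeff (i + k + 1) S).det *
      ((e * e * f * f + f * f) * he + hf)

theorem hurwitzMinor_eq_det {p : Polynomial ℝ} {A : ℝ⟦X⟧}
    (hA : ∀ k, coeff k A = if k ≤ p.natDegree then p.coeff (p.natDegree - k) else 0) (j : ℕ) :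
    hurwitzMinor p j =
      (Matrix.of fun i k : Fin j => coeff (2 * k + 1) (X ^ (i : ℕ) * A)).det := by
  rw [hurwitzMinor]
  congr 1
  ext i k
  simp only [Matrix.of_apply, aCoeff, coeff_X_pow_mul', hA]
  by_cases h : (i : ℕ) ≤ 2 * k + 1
  · have hz : 2 * ((k : ℤ) + 1) - ((i : ℤ) + 1) = ((2 * k + 1 - i : ℕ) : ℤ) := by omega
    rw [hz, Int.toNat_natCast, if_pos h]
    exact if_congr (by omega) rfl rfl
  · rw [if_neg (by omega), if_neg h]

end PowerSeries

/-- Hankel determinants of `R(z) = (-1)^n p(-z)/p(z)` versus Hurwitz minors.  Writing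
`p(z) = Σ_{k=0}^n a_k z^{n-k}` and letting `s_0, s_1, …` be the Laurent coefficients at
infinity of `R`, i.e. (with `w = 1/z`) the formal power series identity
`Σ (-1)^k a_k w^k = (Σ a_k w^k) · (1 + Σ_j s_j w^{j+1})` holds, one has
`a_0^{2j} D_j(R) = (-1)^{j(j+1)/2} 2^j a_0 Δ_{j-1}(p) Δ_j(p)` for every `j ≥ 1`, where
`D_j(R) = det[(s_{i+k})_{i,k=0}^{j-1}]` and `Δ_k(p)` are the Hurwitz minors. -/
theorem hankel_det_of_R_eq_hurwitz_minors
    (n : ℕ) (hn : 1 ≤ n) (p : Polynomial ℝ)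
    (hdeg : p.natDegree = n) (hlead : 0 < p.leadingCoeff)
    (s : ℕ → ℝ)
    (hs : PowerSeries.mk (fun k => (-1 : ℝ) ^ k * (if k ≤ n then p.coeff (n - k) else 0)) =
        PowerSeries.mk (fun k => if k ≤ n then p.coeff (n - k) else 0) *
          PowerSeries.mk (fun j => if j = 0 then 1 else s (j - 1))) :
    ∀ j : ℕ, 1 ≤ j →
      p.leadingCoeff ^ (2 * j) *
          Matrix.det (Matrix.of fun i k : Fin j => s ((i : ℕ) + (k : ℕ))) =
        (-1 : ℝ) ^ (j * (j + 1) / 2) * 2 ^ j * p.leadingCoeff *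
          hurwitzMinor p (j - 1) * hurwitzMinor p j := by
  subst hdeg
  rintro (_ | j) hj
  · omega
  have hA : ∀ k, PowerSeries.coeff k (PowerSeries.mk fun k =>
      if k ≤ p.natDegree then p.coeff (p.natDegree - k) else 0) =
      if k ≤ p.natDegree then p.coeff (p.natDegree - k) else 0 :=
    fun k => PowerSeries.coeff_mk _ _
  have h := PowerSeries.det_hankel_eq _ _
    (fun k => by rw [← hs, PowerSeries.coeff_mk, PowerSeries.coeff_mk]) j
  rw [← PowerSeries.hurwitzMinor_eq_det hA, ← PowerSeries.hurwitzMinor_eq_det hA] at h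
  simpa only [PowerSeries.coeff_mk, zero_le, if_true, Nat.sub_zero, Nat.add_eq_zero_iff,
    one_ne_zero, and_false, if_false, Nat.add_sub_cancel, Polynomial.coeff_natDegree] using h
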